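/- Let Ω⁺ ⊂ ℝ³ be a bounded open set with Lipschitz boundary and let Ω⁻ = {φ > 0} \ closure(Ω⁺) be the open representative of the minimizer of the unconstrained problem. Then every connected component V of Ω⁻ satisfies ∂V ∩ ∂Ω⁺ ≠ ∅. -/

import Mathlib

open MeasureTheory Real
open scoped RealInnerProductSpace

noncomputable section

abbrev E3 := EuclideanSpace ℝ (Fin 3)

/-- The Coulomb kernel in ℝ³. -/
def coul (x y : E3) : ℝ := 1 / (4 * π * ‖x - y‖)

/-- The Coulomb energy `E(Ω⁻)`. -/
def energy (Ωp Ωm : Set E3) : ℝ :=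
  (∫ x in Ωp, ∫ y in Ωp, coul x y) + (∫ x in Ωm, ∫ y in Ωm, coul x y)
    - 2 * ∫ x in Ωp, ∫ y in Ωm, coul x y

/-- Admissible configurations for the unconstrained problem. -/
def Adm (Ωp Ωm : Set E3) : Prop :=
  MeasurableSet Ωm ∧ volume (Ωp ∩ Ωm) = 0 ∧ volume Ωm < ⊤

/-- The potential `φ` generated by the charges `χ_{Ω⁺} − χ_{Ω⁻}`. -/
def potential (Ωp Ωm : Set E3) (x : E3) : ℝ :=
  ∫ y, (Set.indicator Ωp (fun _ => (1:ℝ)) y - Set.indicator Ωm (fun _ => (1:ℝ)) y) * coul x y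

/-- A bounded open set has Lipschitz boundary if near each boundary point, after
choosing a unit direction `ν`, the set is the region above the graph of a
Lipschitz function over the hyperplane orthogonal to `ν`. -/
def HasLipschitzBoundary (Ω : Set E3) : Prop :=
  ∀ x ∈ frontier Ω, ∃ (ν : E3) (ψ : E3 → ℝ) (K : NNReal) (r : ℝ),
    ‖ν‖ = 1 ∧ LipschitzWith K ψ ∧ 0 < r ∧
    ∀ (v : E3) (t : ℝ), ⟪v, ν⟫ = 0 → x + v + t • ν ∈ Metric.ball x r →
      (x + v + t • ν ∈ Ω ↔ ψ v < t)


theorem inv_sqrt_one_add_bounds {u : ℝ} (hu : |u| ≤ 1 / 2) :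
    1 - u / 2 + 3 / 8 * u ^ 2 - |u| ^ 3 ≤ 1 / √(1 + u) ∧
      1 / √(1 + u) ≤ 1 - u / 2 + 3 / 8 * u ^ 2 + |u| ^ 3 := by
  obtain ⟨h1, h2⟩ := abs_le.mp hu
  have hw : 0 < √(1 + u) := Real.sqrt_pos.mpr (by linarith)
  have hsq : √(1 + u) ^ 2 = 1 + u := Real.sq_sqrt (by linarith)
  rw [le_div_iff₀ hw, div_le_iff₀ hw]
  constructor
  · refine (abs_le.mp ((sq_le_one_iff_abs_le_one _).mp ?_)).2
    rw [mul_pow, hsq]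
    rcases abs_cases u with ⟨h, h'⟩ | ⟨h, h'⟩ <;> rw [h]
    · have hq : 0 ≤ -(5 / 8 - 15 / 64 * u + 9 / 64 * u ^ 2
          - 2 * (1 - u / 2 + 3 / 8 * u ^ 2) * (1 + u) + u ^ 3 * (1 + u)) := by
        nlinarith [mul_nonneg h' h', pow_nonneg h' 3, pow_nonneg h' 4,
          mul_nonneg h' (by linarith : 0 ≤ 1 / 2 - u),
          mul_nonneg (pow_nonneg h' 2) (by linarith : 0 ≤ 1 / 2 - u),
          mul_nonneg (pow_nonneg h' 3) (by linarith : 0 ≤ 1 / 2 - u)]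
      linarith [mul_nonneg (pow_nonneg h' 3) hq]
    · obtain ⟨v, rfl⟩ : ∃ v, u = -v := ⟨-u, by ring⟩
      have h' : 0 ≤ v := by linarith
      have hq : 0 ≤ 5 / 8 + 15 / 64 * v + 9 / 64 * v ^ 2
          + 2 * (1 + v / 2 + 3 / 8 * v ^ 2) * (1 - v) - v ^ 3 * (1 - v) := by
        nlinarith [mul_nonneg h' h', pow_nonneg h' 3, pow_nonneg h' 4,
          mul_nonneg h' (by linarith : 0 ≤ 1 / 2 - v),
          mul_nonneg (pow_nonneg h' 2) (by linarith : 0 ≤ 1 / 2 - v),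
          mul_nonneg (pow_nonneg h' 3) (by linarith : 0 ≤ 1 / 2 - v)]
      linarith [mul_nonneg (pow_nonneg h' 3) hq]
  · have hp : 0 ≤ 1 - u / 2 + 3 / 8 * u ^ 2 + |u| ^ 3 := by
      have := pow_nonneg (abs_nonneg u) 3
      nlinarith [sq_nonneg u]
    refine (one_le_sq_iff₀ (mul_nonneg hp hw.le)).mp ?_
    rw [mul_pow, hsq]
    rcases abs_cases u with ⟨h, h'⟩ | ⟨h, h'⟩ <;> rw [h]
    · have hq : 0 ≤ 5 / 8 - 15 / 64 * u + 9 / 64 * u ^ 2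
          + 2 * (1 - u / 2 + 3 / 8 * u ^ 2) * (1 + u) + u ^ 3 * (1 + u) := by
        nlinarith [mul_nonneg h' h', pow_nonneg h' 3, pow_nonneg h' 4,
          mul_nonneg h' (by linarith : 0 ≤ 1 / 2 - u),
          mul_nonneg (pow_nonneg h' 2) (by linarith : 0 ≤ 1 / 2 - u)]
      linarith [mul_nonneg (pow_nonneg h' 3) hq]
    · obtain ⟨v, rfl⟩ : ∃ v, u = -v := ⟨-u, by ring⟩
      have h' : 0 ≤ v := by linarith
      have hq : 0 ≤ -5 / 8 - 15 / 64 * v - 9 / 64 * v ^ 2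
          + 2 * (1 + v / 2 + 3 / 8 * v ^ 2) * (1 - v) + v ^ 3 * (1 - v) := by
        nlinarith [mul_nonneg h' h', pow_nonneg h' 3, pow_nonneg h' 4,
          mul_nonneg h' (by linarith : 0 ≤ 1 / 2 - v),
          mul_nonneg (pow_nonneg h' 2) (by linarith : 0 ≤ 1 / 2 - v),
          mul_nonneg (pow_nonneg h' 3) (by linarith : 0 ≤ 1 / 2 - v)]
      linarith [mul_nonneg (pow_nonneg h' 3) hq]

theorem integrableOn_inv_norm_sq_ball :
    IntegrableOn (fun z : E3 => 1 / ‖z‖ ^ 2) (Metric.ball 0 1) := by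
  refine (integrableOn_fun_norm_addHaar (E := E3) volume (f := fun r => 1 / r ^ 2)).mpr ?_
  have hc : IntegrableOn (fun _ : ℝ => (1 : ℝ)) (Set.Ioo 0 1) := integrableOn_const (by simp)
  refine hc.congr_fun (fun r hr => ?_) measurableSet_Ioo
  have : r ≠ 0 := hr.1.ne'
  simp [this]

/-- The potential of the charge density `f`. -/
def newton (f : E3 → ℝ) (x : E3) : ℝ := ∫ y, f y * coul x y

/-- The Coulomb kernel, regularized at the length scale `ε`. -/
def regCoul (ε : ℝ) (z : E3) : ℝ := 1 / (4 * π) * (1 / √(‖z‖ ^ 2 + ε ^ 2))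

/-- The potential of the charge density `f` for the regularized kernel. -/
def regNewton (ε : ℝ) (f : E3 → ℝ) (x : E3) : ℝ := ∫ y, f y * regCoul ε (x - y)

/-- The integral of `‖z‖⁻²` over the unit ball. -/
def ballConst : ℝ := ∫ z in Metric.ball (0 : E3) 1, 1 / ‖z‖ ^ 2

theorem integral_inv_norm_sq_le {f : E3 → ℝ} (hf : Integrable f) (hf1 : ∀ y, |f y| ≤ 1) (x : E3) :
    Integrable (fun y => |f y| * (1 / ‖x - y‖ ^ 2)) ∧
      ∫ y, |f y| * (1 / ‖x - y‖ ^ 2) ≤ ballConst + ∫ y, |f y| := by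
  set I : E3 → ℝ := Set.indicator (Metric.ball 0 1) (fun z => 1 / ‖z‖ ^ 2) with hI
  have hIi : Integrable I := integrableOn_inv_norm_sq_ball.integrable_indicator
    Metric.isOpen_ball.measurableSet
  have hdom : ∀ y, |f y| * (1 / ‖x - y‖ ^ 2) ≤ I (x - y) + |f y| := by
    intro y
    by_cases h : x - y ∈ Metric.ball (0 : E3) 1
    · rw [hI, Set.indicator_of_mem h]
      have h0 : 0 ≤ 1 / ‖x - y‖ ^ 2 := by positivity
      nlinarith [hf1 y, abs_nonneg (f y)]
    · rw [hI, Set.indicator_of_notMem h, zero_add]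
      simp only [mem_ball_zero_iff, not_lt] at h
      refine mul_le_of_le_one_right (abs_nonneg _) ?_
      rw [div_le_one (by positivity)]
      exact one_le_pow₀ h
  have hsum : Integrable (fun y => I (x - y) + |f y|) := (hIi.comp_sub_left x).add hf.abs
  have hint : Integrable (fun y => |f y| * (1 / ‖x - y‖ ^ 2)) := by
    refine hsum.mono' ?_ (Filter.Eventually.of_forall fun y => ?_)
    · exact hf.abs.aestronglyMeasurable.mul (Measurable.aestronglyMeasurable (by fun_prop))
    · rw [Real.norm_of_nonneg (by positivity)]
      exact hdom y
  refine ⟨hint, (integral_mono hint hsum hdom).trans_eq ?_⟩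
  rw [integral_add (hIi.comp_sub_left x) hf.abs, integral_sub_left_eq_self I volume x,
    integral_indicator Metric.isOpen_ball.measurableSet]
  rfl

theorem coul_nonneg (x y : E3) : 0 ≤ coul x y := by
  unfold coul; positivity

theorem regCoul_nonneg (ε : ℝ) (z : E3) : 0 ≤ regCoul ε z := by
  unfold regCoul; positivity

theorem one_div_four_pi_le_one : 1 / (4 * π) ≤ 1 := by
  rw [div_le_one (by positivity)]
  linarith [Real.pi_gt_three]

theorem coul_le (x y : E3) : coul x y ≤ 1 / ‖x - y‖ ^ 2 + 1 := by
  have h : coul x y = 1 / (4 * π) * (1 / ‖x - y‖) := by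
    unfold coul; rw [one_div_mul_one_div]
  rw [h]
  have h0 : 0 ≤ 1 / ‖x - y‖ := by positivity
  have h1 := mul_le_of_le_one_left h0 one_div_four_pi_le_one
  rw [← one_div_pow]
  nlinarith [sq_nonneg (1 / ‖x - y‖ - 1)]

theorem continuous_regCoul {ε : ℝ} (hε : 0 < ε) : Continuous (regCoul ε) := by
  unfold regCoul
  refine continuous_const.mul (continuous_const.div (by fun_prop) fun z => ?_)
  positivity

theorem regCoul_le {ε : ℝ} (hε : 0 < ε) (z : E3) : regCoul ε z ≤ 1 / ε := by
  unfold regCoul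
  refine (mul_le_of_le_one_left (by positivity) one_div_four_pi_le_one).trans ?_
  refine one_div_le_one_div_of_le hε (Real.le_sqrt_of_sq_le ?_)
  nlinarith [sq_nonneg ‖z‖]

theorem abs_coul_sub_regCoul_le {ε : ℝ} (hε : 0 < ε) {x y : E3} (hxy : x ≠ y) :
    |coul x y - regCoul ε (x - y)| ≤ ε * (1 / ‖x - y‖ ^ 2) := by
  have ha : 0 < ‖x - y‖ := norm_pos_iff.mpr (sub_ne_zero.mpr hxy)
  have h : coul x y = 1 / (4 * π) * (1 / ‖x - y‖) := by
    unfold coul; rw [one_div_mul_one_div]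
  rw [h, regCoul, ← mul_sub, abs_mul, abs_of_nonneg (by positivity : 0 ≤ 1 / (4 * π))]
  refine (mul_le_of_le_one_left (abs_nonneg _) one_div_four_pi_le_one).trans ?_
  set a := ‖x - y‖
  have hs2 : √(a ^ 2 + ε ^ 2) ^ 2 = a ^ 2 + ε ^ 2 := Real.sq_sqrt (by positivity)
  set s := √(a ^ 2 + ε ^ 2)
  have hsa : a ≤ s := Real.le_sqrt_of_sq_le (by nlinarith)
  have hsε : s ≤ a + ε := by
    refine Real.sqrt_le_iff.mpr ⟨by positivity, by nlinarith⟩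
  have hs : 0 < s := ha.trans_le hsa
  rw [abs_of_nonneg (sub_nonneg.mpr (one_div_le_one_div_of_le ha hsa)),
    div_sub_div _ _ ha.ne' hs.ne', mul_one_div, div_le_div_iff₀ (by positivity) (by positivity)]
  nlinarith [mul_le_mul_of_nonneg_left hsa (by positivity : 0 ≤ a * ε), pow_pos ha 2]

theorem integrable_mul_coul {f : E3 → ℝ} (hf : Integrable f) (hf1 : ∀ y, |f y| ≤ 1) (x : E3) :
    Integrable (fun y => f y * coul x y) := by
  refine ((integral_inv_norm_sq_le hf hf1 x).1.add hf.abs).mono'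
    (hf.aestronglyMeasurable.mul ?_) (Filter.Eventually.of_forall fun y => ?_)
  · unfold coul; exact Measurable.aestronglyMeasurable (by fun_prop)
  · rw [norm_mul, Real.norm_of_nonneg (coul_nonneg x y), Real.norm_eq_abs, Pi.add_apply]
    nlinarith [mul_le_mul_of_nonneg_left (coul_le x y) (abs_nonneg (f y))]

theorem integrable_mul_regCoul {f : E3 → ℝ} (hf : Integrable f) {ε : ℝ} (hε : 0 < ε) (x : E3) :
    Integrable (fun y => f y * regCoul ε (x - y)) := by
  refine hf.mul_bdd (c := 1 / ε) ?_ (Filter.Eventually.of_forall fun y => ?_)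
  · exact ((continuous_regCoul hε).comp (by fun_prop)).aestronglyMeasurable
  · rw [Real.norm_of_nonneg (regCoul_nonneg _ _)]
    exact regCoul_le hε _

theorem abs_newton_sub_regNewton_le {f : E3 → ℝ} (hf : Integrable f) (hf1 : ∀ y, |f y| ≤ 1)
    {ε : ℝ} (hε : 0 < ε) (x : E3) :
    |newton f x - regNewton ε f x| ≤ ε * (ballConst + ∫ y, |f y|) := by
  obtain ⟨hi, hle⟩ := integral_inv_norm_sq_le hf hf1 x
  rw [newton, regNewton, ← integral_sub (integrable_mul_coul hf hf1 x)
    (integrable_mul_regCoul hf hε x), ← Real.norm_eq_abs]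
  refine (norm_integral_le_of_norm_le (hi.const_mul ε) ?_).trans ?_
  · have hne : ∀ᵐ y : E3, x ≠ y := by
      filter_upwards [Measure.ae_ne volume x] with y hy using hy.symm
    filter_upwards [hne] with y hy
    rw [← mul_sub, norm_mul, Real.norm_eq_abs, Real.norm_eq_abs]
    calc |f y| * |coul x y - regCoul ε (x - y)| ≤ |f y| * (ε * (1 / ‖x - y‖ ^ 2)) :=
          mul_le_mul_of_nonneg_left (abs_coul_sub_regCoul_le hε hy) (abs_nonneg _)
      _ = _ := by ring
  · rw [integral_const_mul]
    exact mul_le_mul_of_nonneg_left hle hε.le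

theorem continuous_regNewton {f : E3 → ℝ} (hf : Integrable f) {ε : ℝ} (hε : 0 < ε) :
    Continuous (regNewton ε f) := by
  refine continuous_of_dominated (bound := fun y => |f y| * (1 / ε))
    (fun x => (integrable_mul_regCoul hf hε x).aestronglyMeasurable)
    (fun x => Filter.Eventually.of_forall fun y => ?_) (hf.abs.mul_const _)
    (Filter.Eventually.of_forall fun y => ?_)
  · rw [norm_mul, Real.norm_of_nonneg (regCoul_nonneg _ _), Real.norm_eq_abs]
    exact mul_le_mul_of_nonneg_left (regCoul_le hε _) (abs_nonneg _)
  · exact continuous_const.mul ((continuous_regCoul hε).comp (by fun_prop))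

theorem tendsto_regNewton {f : E3 → ℝ} (hf : Integrable f) {ε : ℝ} (hε : 0 < ε) :
    Filter.Tendsto (regNewton ε f) (Filter.cocompact E3) (nhds 0) := by
  have hgen : (Filter.cocompact E3).IsCountablyGenerated := by
    rw [← Metric.cobounded_eq_cocompact, ← comap_norm_atTop]; infer_instance
  have h := tendsto_integral_filter_of_dominated_convergence (μ := volume)
    (F := fun x y => f y * regCoul ε (x - y)) (f := fun _ => (0 : ℝ)) (l := Filter.cocompact E3)
    (fun y => |f y| * (1 / ε))
    (Filter.Eventually.of_forall fun x => (integrable_mul_regCoul hf hε x).aestronglyMeasurable)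
    (Filter.Eventually.of_forall fun x => Filter.Eventually.of_forall fun y => ?_)
    (hf.abs.mul_const _) (Filter.Eventually.of_forall fun y => ?_)
  · rwa [integral_zero] at h
  · rw [norm_mul, Real.norm_of_nonneg (regCoul_nonneg _ _), Real.norm_eq_abs]
    exact mul_le_mul_of_nonneg_left (regCoul_le hε _) (abs_nonneg _)
  · rw [← mul_zero (f y)]
    refine Filter.Tendsto.const_mul _ ?_
    have h1 : Filter.Tendsto (fun x : E3 => x - y) (Filter.cocompact E3) (Filter.cocompact E3) :=
      (Homeomorph.subRight y).isClosedEmbedding.tendsto_cocompact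
    have h2 := (tendsto_norm_cocompact_atTop (E := E3)).comp h1
    have h3 : Filter.Tendsto (fun x : E3 => √(‖x - y‖ ^ 2 + ε ^ 2)) (Filter.cocompact E3)
        Filter.atTop :=
      Filter.tendsto_atTop_mono (fun x => Real.le_sqrt_of_sq_le
        (le_add_of_nonneg_right (sq_nonneg ε))) h2
    simpa [regCoul] using h3.inv_tendsto_atTop.const_mul (1 / (4 * π))

theorem tendstoUniformly_regNewton {f : E3 → ℝ} (hf : Integrable f) (hf1 : ∀ y, |f y| ≤ 1) :
    TendstoUniformly (fun ε => regNewton ε f) (newton f) (nhdsWithin 0 (Set.Ioi 0)) := by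
  rw [Metric.tendstoUniformly_iff]
  intro η hη
  have h : Filter.Tendsto (fun ε : ℝ => ε * (ballConst + ∫ y, |f y|))
      (nhdsWithin 0 (Set.Ioi 0)) (nhds 0) := by
    have := ((continuous_id (X := ℝ)).mul_const (ballConst + ∫ y, |f y|)).tendsto 0
    simp only [id, zero_mul] at this
    exact this.mono_left nhdsWithin_le_nhds
  filter_upwards [h.eventually_lt_const hη, self_mem_nhdsWithin] with ε hε hpos x
  rw [Real.dist_eq]
  exact (abs_newton_sub_regNewton_le hf hf1 hpos x).trans_lt hε

theorem continuous_newton {f : E3 → ℝ} (hf : Integrable f) (hf1 : ∀ y, |f y| ≤ 1) :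
    Continuous (newton f) := by
  refine (tendstoUniformly_regNewton hf hf1).continuous (Filter.Eventually.frequently ?_)
  filter_upwards [self_mem_nhdsWithin] with ε hε using continuous_regNewton hf hε

theorem tendsto_newton {f : E3 → ℝ} (hf : Integrable f) (hf1 : ∀ y, |f y| ≤ 1) :
    Filter.Tendsto (newton f) (Filter.cocompact E3) (nhds 0) := by
  refine (tendstoUniformly_regNewton hf hf1).tendstoUniformlyOnFilter.mono_right le_top
    |>.tendsto_of_eventually_tendsto (L := fun _ => 0) ?_ tendsto_const_nhds
  filter_upwards [self_mem_nhdsWithin] with ε hε using tendsto_regNewton hf hε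

theorem inv_sqrt_add_eq {r u : ℝ} (hr : 0 < r) {w : ℝ} (hw : w = r ^ 2 * (1 + u)) :
    1 / √w = 1 / r * (1 / √(1 + u)) := by
  rw [hw, Real.sqrt_mul (sq_nonneg r), Real.sqrt_sq hr.le, one_div_mul_one_div]

theorem abs_second_difference_inv_sqrt_le {r ε h X : ℝ} (hε : 0 < ε) (hεr : ε ≤ r) (hh : 0 < h)
    (hhε : h ≤ ε / 6) (hX : |X| ≤ r) :
    |1 / √(r ^ 2 + h ^ 2 + 2 * h * X) + 1 / √(r ^ 2 + h ^ 2 - 2 * h * X) - 2 * (1 / r)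
      - 1 / r * (-h ^ 2 / r ^ 2 + 3 * h ^ 2 * X ^ 2 / r ^ 4 + 3 / 4 * h ^ 4 / r ^ 4)|
      ≤ 1 / r * (54 * (h / ε) ^ 3) := by
  have hr : 0 < r := hε.trans_le hεr
  have key : ∀ Y : ℝ, |Y| ≤ r → |(h ^ 2 + 2 * h * Y) / r ^ 2| ≤ 3 * (h / ε) := by
    intro Y hY
    have hYr := abs_le.mp hY
    have e1 : |h ^ 2 + 2 * h * Y| ≤ 3 * h * r := by
      rw [abs_le]; constructor <;> nlinarith
    rw [abs_div, abs_of_pos (pow_pos hr 2), ← mul_div_assoc, div_le_div_iff₀ (by positivity) hε]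
    calc |h ^ 2 + 2 * h * Y| * ε ≤ 3 * h * r * r := by gcongr
      _ = _ := by ring
  have hhalf : 3 * (h / ε) ≤ 1 / 2 := by
    rw [← mul_div_assoc, div_le_iff₀ hε]; linarith
  have k1 := key X hX
  have k2 := key (-X) (by rwa [abs_neg])
  have c1 := pow_le_pow_left₀ (abs_nonneg _) k1 3
  have c2 := pow_le_pow_left₀ (abs_nonneg _) k2 3
  have b1 := inv_sqrt_one_add_bounds (k1.trans hhalf)
  have b2 := inv_sqrt_one_add_bounds (k2.trans hhalf)
  rw [inv_sqrt_add_eq (w := r ^ 2 + h ^ 2 + 2 * h * X) (u := (h ^ 2 + 2 * h * X) / r ^ 2) hr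
      (by field_simp; ring),
    inv_sqrt_add_eq (w := r ^ 2 + h ^ 2 - 2 * h * X) (u := (h ^ 2 + 2 * h * -X) / r ^ 2) hr
      (by field_simp; ring)]
  set u := (h ^ 2 + 2 * h * X) / r ^ 2 with hu
  set v := (h ^ 2 + 2 * h * -X) / r ^ 2 with hv
  have huv : -h ^ 2 / r ^ 2 + 3 * h ^ 2 * X ^ 2 / r ^ 4 + 3 / 4 * h ^ 4 / r ^ 4
      = -(u + v) / 2 + 3 / 8 * (u ^ 2 + v ^ 2) := by
    rw [hu, hv]; field_simp; ring
  rw [huv, ← mul_add, mul_comm 2, ← mul_sub, ← mul_sub, abs_mul, abs_of_pos (one_div_pos.mpr hr)]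
  refine mul_le_mul_of_nonneg_left ?_ (one_div_pos.mpr hr).le
  rw [abs_le]
  constructor <;> nlinarith

/-- The standard second order difference approximating the Laplacian. -/
def discreteLaplacian (h : ℝ) (g : E3 → ℝ) (x : E3) : ℝ :=
  ∑ i : Fin 3, (g (x + EuclideanSpace.single i h) + g (x - EuclideanSpace.single i h) - 2 * g x)

theorem norm_sq_add_single (z : E3) (i : Fin 3) (h : ℝ) :
    ‖z + EuclideanSpace.single i h‖ ^ 2 = ‖z‖ ^ 2 + h ^ 2 + 2 * h * z i := by
  rw [norm_add_sq_real]
  simp [EuclideanSpace.inner_single_right]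
  ring

theorem norm_sq_sub_single (z : E3) (i : Fin 3) (h : ℝ) :
    ‖z - EuclideanSpace.single i h‖ ^ 2 = ‖z‖ ^ 2 + h ^ 2 - 2 * h * z i := by
  rw [norm_sub_sq_real]
  simp [EuclideanSpace.inner_single_right]
  ring

theorem abs_discreteLaplacian_regCoul_le {ε h : ℝ} (hε : 0 < ε) (hh : 0 < h) (hhε : h ≤ ε / 6)
    (z : E3) :
    |4 * π * discreteLaplacian h (regCoul ε) z
      - 1 / √(‖z‖ ^ 2 + ε ^ 2) * (-3 * h ^ 2 * ε ^ 2 / (‖z‖ ^ 2 + ε ^ 2) ^ 2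
        + 9 / 4 * h ^ 4 / (‖z‖ ^ 2 + ε ^ 2) ^ 2)|
      ≤ 1 / √(‖z‖ ^ 2 + ε ^ 2) * (162 * (h / ε) ^ 3) := by
  have hr2 : √(‖z‖ ^ 2 + ε ^ 2) ^ 2 = ‖z‖ ^ 2 + ε ^ 2 := Real.sq_sqrt (by positivity)
  have hεr : ε ≤ √(‖z‖ ^ 2 + ε ^ 2) := Real.le_sqrt_of_sq_le (by nlinarith [sq_nonneg ‖z‖])
  have hz : ‖z‖ ≤ √(‖z‖ ^ 2 + ε ^ 2) := Real.le_sqrt_of_sq_le (by nlinarith [sq_nonneg ε])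
  have hX : ∀ i, |z i| ≤ √(‖z‖ ^ 2 + ε ^ 2) := fun i =>
    (PiLp.norm_apply_le z i).trans hz
  have hsum : ‖z‖ ^ 2 = z 0 ^ 2 + z 1 ^ 2 + z 2 ^ 2 := by
    rw [EuclideanSpace.real_norm_sq_eq, Fin.sum_univ_three]
  have hterm := fun i => abs_second_difference_inv_sqrt_le hε hεr hh hhε (hX i)
  have h0 := abs_le.mp (hterm 0)
  have h1 := abs_le.mp (hterm 1)
  have h2 := abs_le.mp (hterm 2)
  have hexp : 4 * π * discreteLaplacian h (regCoul ε) z = ∑ i : Fin 3,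
      (1 / √(√(‖z‖ ^ 2 + ε ^ 2) ^ 2 + h ^ 2 + 2 * h * z i)
        + 1 / √(√(‖z‖ ^ 2 + ε ^ 2) ^ 2 + h ^ 2 - 2 * h * z i)
        - 2 * (1 / √(‖z‖ ^ 2 + ε ^ 2))) := by
    rw [discreteLaplacian, Finset.mul_sum]
    refine Finset.sum_congr rfl fun i _ => ?_
    have e1 : ‖z‖ ^ 2 + h ^ 2 + 2 * h * z i + ε ^ 2
        = ‖z‖ ^ 2 + ε ^ 2 + h ^ 2 + 2 * h * z i := by ring
    have e2 : ‖z‖ ^ 2 + h ^ 2 - 2 * h * z i + ε ^ 2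
        = ‖z‖ ^ 2 + ε ^ 2 + h ^ 2 - 2 * h * z i := by ring
    rw [hr2, regCoul, regCoul, regCoul, norm_sq_add_single, norm_sq_sub_single, e1, e2]
    field_simp
  rw [hexp, Fin.sum_univ_three]
  have hr : 0 < √(‖z‖ ^ 2 + ε ^ 2) := hε.trans_le hεr
  have hmain : -3 * h ^ 2 * ε ^ 2 / (‖z‖ ^ 2 + ε ^ 2) ^ 2 + 9 / 4 * h ^ 4 / (‖z‖ ^ 2 + ε ^ 2) ^ 2
      = ∑ i : Fin 3, (-h ^ 2 / √(‖z‖ ^ 2 + ε ^ 2) ^ 2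
        + 3 * h ^ 2 * z i ^ 2 / √(‖z‖ ^ 2 + ε ^ 2) ^ 4
        + 3 / 4 * h ^ 4 / √(‖z‖ ^ 2 + ε ^ 2) ^ 4) := by
    have h4 : √(‖z‖ ^ 2 + ε ^ 2) ^ 4 = (‖z‖ ^ 2 + ε ^ 2) ^ 2 := by
      calc _ = (√(‖z‖ ^ 2 + ε ^ 2) ^ 2) ^ 2 := by ring
        _ = _ := by rw [hr2]
    have hs : 0 < ‖z‖ ^ 2 + ε ^ 2 := by positivity
    rw [h4, hr2, Fin.sum_univ_three]
    have hε2 : ε ^ 2 = (‖z‖ ^ 2 + ε ^ 2) - (z 0 ^ 2 + z 1 ^ 2 + z 2 ^ 2) := by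
      rw [← hsum]; ring
    generalize ‖z‖ ^ 2 + ε ^ 2 = s at *
    rw [hε2]
    field_simp
    ring
  rw [hmain, Fin.sum_univ_three, abs_le]
  constructor <;> linarith

theorem discreteLaplacian_regCoul_le {ε h : ℝ} (hε : 0 < ε) (hh : 0 < h) (hhε : h ≤ ε / 6)
    (z : E3) : discreteLaplacian h (regCoul ε) z ≤ 163 / ε ^ 4 * h ^ 3 := by
  have hb := (abs_le.mp (abs_discreteLaplacian_regCoul_le hε hh hhε z)).2
  have hεr : ε ≤ √(‖z‖ ^ 2 + ε ^ 2) := Real.le_sqrt_of_sq_le (by nlinarith [sq_nonneg ‖z‖])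
  have hr : 0 < √(‖z‖ ^ 2 + ε ^ 2) := hε.trans_le hεr
  have hi : 1 / √(‖z‖ ^ 2 + ε ^ 2) ≤ 1 / ε := one_div_le_one_div_of_le hε hεr
  have hn : -3 * h ^ 2 * ε ^ 2 / (‖z‖ ^ 2 + ε ^ 2) ^ 2 ≤ 0 :=
    div_nonpos_of_nonpos_of_nonneg (by nlinarith [mul_nonneg (sq_nonneg h) (sq_nonneg ε)])
      (by positivity)
  have hq : 9 / 4 * h ^ 4 / (‖z‖ ^ 2 + ε ^ 2) ^ 2 ≤ (h / ε) ^ 3 := by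
    have hle : ε ^ 4 ≤ (‖z‖ ^ 2 + ε ^ 2) ^ 2 := by nlinarith [sq_nonneg ‖z‖, sq_nonneg ε]
    rw [div_pow, div_le_div_iff₀ (by positivity) (by positivity)]
    calc 9 / 4 * h ^ 4 * ε ^ 3 = 9 / 4 * h * (h ^ 3 * ε ^ 3) := by ring
      _ ≤ ε * (h ^ 3 * ε ^ 3) := by gcongr; linarith
      _ = h ^ 3 * ε ^ 4 := by ring
      _ ≤ _ := by gcongr
  have hfin : 4 * π * discreteLaplacian h (regCoul ε) z ≤ 163 / ε ^ 4 * h ^ 3 := by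
    calc _ ≤ 1 / √(‖z‖ ^ 2 + ε ^ 2) * (163 * (h / ε) ^ 3) := by
          nlinarith [mul_le_mul_of_nonneg_left (add_le_add hn hq) (one_div_pos.mpr hr).le]
      _ ≤ 1 / ε * (163 * (h / ε) ^ 3) := by gcongr
      _ = _ := by field_simp
  have hC : 0 ≤ 163 / ε ^ 4 * h ^ 3 := by positivity
  nlinarith [Real.pi_gt_three]

theorem le_discreteLaplacian_regCoul {ε h d : ℝ} (hε : 0 < ε) (hh : 0 < h) (hhε : h ≤ ε / 6)
    (hd : 0 < d) {z : E3} (hz : d ≤ ‖z‖) :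
    -(3 * ε ^ 2 / d ^ 5 * h ^ 2 + 162 / ε ^ 4 * h ^ 3) ≤ discreteLaplacian h (regCoul ε) z := by
  have hb := (abs_le.mp (abs_discreteLaplacian_regCoul_le hε hh hhε z)).1
  have hεr : ε ≤ √(‖z‖ ^ 2 + ε ^ 2) := Real.le_sqrt_of_sq_le (by nlinarith [sq_nonneg ‖z‖])
  have hdr : d ≤ √(‖z‖ ^ 2 + ε ^ 2) := Real.le_sqrt_of_sq_le (by nlinarith [sq_nonneg ε])
  have hr : 0 < √(‖z‖ ^ 2 + ε ^ 2) := hε.trans_le hεr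
  have hq : 0 ≤ 1 / √(‖z‖ ^ 2 + ε ^ 2) * (9 / 4 * h ^ 4 / (‖z‖ ^ 2 + ε ^ 2) ^ 2) := by positivity
  have hds : d ^ 4 ≤ (‖z‖ ^ 2 + ε ^ 2) ^ 2 := by
    have : d ^ 2 ≤ ‖z‖ ^ 2 + ε ^ 2 := by nlinarith [sq_nonneg ε]
    calc d ^ 4 = (d ^ 2) ^ 2 := by ring
      _ ≤ _ := by gcongr
  have h1 : 1 / √(‖z‖ ^ 2 + ε ^ 2) * (3 * h ^ 2 * ε ^ 2 / (‖z‖ ^ 2 + ε ^ 2) ^ 2)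
      ≤ 3 * ε ^ 2 / d ^ 5 * h ^ 2 := by
    calc _ ≤ 1 / d * (3 * h ^ 2 * ε ^ 2 / d ^ 4) := by gcongr
      _ = _ := by field_simp
  have h2 : 1 / √(‖z‖ ^ 2 + ε ^ 2) * (162 * (h / ε) ^ 3) ≤ 162 / ε ^ 4 * h ^ 3 := by
    calc _ ≤ 1 / ε * (162 * (h / ε) ^ 3) := by gcongr
      _ = _ := by field_simp
  have hneg : -3 * h ^ 2 * ε ^ 2 / (‖z‖ ^ 2 + ε ^ 2) ^ 2
      = -(3 * h ^ 2 * ε ^ 2 / (‖z‖ ^ 2 + ε ^ 2) ^ 2) := by ring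
  rw [hneg] at hb
  have hC : 0 ≤ 3 * ε ^ 2 / d ^ 5 * h ^ 2 + 162 / ε ^ 4 * h ^ 3 := by positivity
  nlinarith [Real.pi_gt_three]

theorem discreteLaplacian_add (h : ℝ) (g k : E3 → ℝ) (x : E3) :
    discreteLaplacian h (fun z => g z + k z) x
      = discreteLaplacian h g x + discreteLaplacian h k x := by
  simp only [discreteLaplacian, ← Finset.sum_add_distrib]
  exact Finset.sum_congr rfl fun i _ => by ring

theorem discreteLaplacian_const_mul_norm_sq (h δ : ℝ) (x : E3) :
    discreteLaplacian h (fun z => δ * ‖z‖ ^ 2) x = 6 * δ * h ^ 2 := by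
  simp only [discreteLaplacian, norm_sq_add_single, norm_sq_sub_single, Fin.sum_univ_three]
  ring

theorem discreteLaplacian_regNewton {f : E3 → ℝ} (hf : Integrable f) {ε : ℝ} (hε : 0 < ε)
    (h : ℝ) (x : E3) :
    Integrable (fun y => f y * discreteLaplacian h (regCoul ε) (x - y)) ∧
      discreteLaplacian h (regNewton ε f) x
        = ∫ y, f y * discreteLaplacian h (regCoul ε) (x - y) := by
  have hi := integrable_mul_regCoul hf hε
  have hti : ∀ i : Fin 3, Integrable (fun y => f y * regCoul ε (x + EuclideanSpace.single i h - y)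
      + f y * regCoul ε (x - EuclideanSpace.single i h - y) - 2 * (f y * regCoul ε (x - y))) :=
    fun i => ((hi _).add (hi _)).sub ((hi _).const_mul 2)
  have heq : (fun y => f y * discreteLaplacian h (regCoul ε) (x - y)) = fun y => ∑ i : Fin 3,
      (f y * regCoul ε (x + EuclideanSpace.single i h - y)
        + f y * regCoul ε (x - EuclideanSpace.single i h - y) - 2 * (f y * regCoul ε (x - y))) := by
    funext y
    rw [discreteLaplacian, Finset.mul_sum]
    refine Finset.sum_congr rfl fun i _ => ?_
    rw [sub_add_eq_add_sub, sub_right_comm]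
    ring
  rw [heq]
  refine ⟨integrable_finsetSum _ fun i _ => hti i, ?_⟩
  rw [integral_finsetSum _ fun i _ => hti i, discreteLaplacian]
  refine Finset.sum_congr rfl fun i _ => ?_
  have hs := integral_sub ((hi (x + EuclideanSpace.single i h)).add
    (hi (x - EuclideanSpace.single i h))) ((hi x).const_mul 2)
  simp only [Pi.add_apply] at hs
  rw [hs, integral_add (hi _) (hi _), integral_const_mul]
  rfl

theorem discreteLaplacian_nonpos_of_isLocalMax {g : E3 → ℝ} {x : E3} (hg : IsLocalMax g x) :
    ∀ᶠ h in nhdsWithin 0 (Set.Ioi 0), discreteLaplacian h g x ≤ 0 := by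
  obtain ⟨r, hr, hball⟩ := Metric.eventually_nhds_iff.mp hg
  filter_upwards [Ioo_mem_nhdsGT hr] with h hh
  refine Finset.sum_nonpos fun i _ => ?_
  have hs : ‖EuclideanSpace.single i h‖ < r := by
    rw [PiLp.norm_single, Real.norm_of_nonneg hh.1.le]
    exact hh.2
  have h1 := hball (y := x + EuclideanSpace.single i h) (by simpa [dist_eq_norm] using hs)
  have h2 := hball (y := x - EuclideanSpace.single i h) (by simpa [dist_eq_norm] using hs)
  linarith

/-- The charge density of the configuration `(Ωp, Ωm)`. -/
def charge (Ωp Ωm : Set E3) (y : E3) : ℝ :=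
  Set.indicator Ωp (fun _ => (1 : ℝ)) y - Set.indicator Ωm (fun _ => (1 : ℝ)) y

theorem abs_charge_le_one (Ωp Ωm : Set E3) (y : E3) : |charge Ωp Ωm y| ≤ 1 := by
  unfold charge Set.indicator
  split_ifs <;> simp

theorem integrable_indicator_one {A : Set E3} (hA : MeasurableSet A) (hv : volume A < ⊤) :
    Integrable (Set.indicator A fun _ => (1 : ℝ)) :=
  (integrable_indicator_iff hA).mpr (integrableOn_const hv.ne)

theorem integrable_charge {Ωp Ωm : Set E3} (hp : MeasurableSet Ωp) (hpv : volume Ωp < ⊤)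
    (hm : MeasurableSet Ωm) (hmv : volume Ωm < ⊤) : Integrable (charge Ωp Ωm) :=
  (integrable_indicator_one hp hpv).sub (integrable_indicator_one hm hmv)

theorem le_discreteLaplacian_regNewton_charge {Ωp Ωm : Set E3}
    (hp : MeasurableSet Ωp) (hpv : volume Ωp < ⊤) (hm : MeasurableSet Ωm) (hmv : volume Ωm < ⊤)
    {ε h d : ℝ} (hε : 0 < ε) (hh : 0 < h) (hhε : h ≤ ε / 6) (hd : 0 < d) {x : E3}
    (hx : ∀ y ∈ Ωp, d ≤ ‖x - y‖) :
    -((3 * ε ^ 2 / d ^ 5 * h ^ 2 + 162 / ε ^ 4 * h ^ 3) * volume.real Ωp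
        + 163 / ε ^ 4 * h ^ 3 * volume.real Ωm)
      ≤ discreteLaplacian h (regNewton ε (charge Ωp Ωm)) x := by
  obtain ⟨hi, heq⟩ := discreteLaplacian_regNewton (integrable_charge hp hpv hm hmv) hε h x
  have hip := (integrable_indicator_one hp hpv).const_mul
    (3 * ε ^ 2 / d ^ 5 * h ^ 2 + 162 / ε ^ 4 * h ^ 3)
  have him := (integrable_indicator_one hm hmv).const_mul (163 / ε ^ 4 * h ^ 3)
  rw [heq]
  calc _ = ∫ y, -((3 * ε ^ 2 / d ^ 5 * h ^ 2 + 162 / ε ^ 4 * h ^ 3)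
          * Set.indicator Ωp (fun _ => (1 : ℝ)) y
        + 163 / ε ^ 4 * h ^ 3 * Set.indicator Ωm (fun _ => (1 : ℝ)) y) := by
        rw [integral_neg, integral_add hip him, integral_const_mul, integral_const_mul,
          integral_indicator_const _ hp, integral_indicator_const _ hm]
        simp
    _ ≤ _ := by
        refine integral_mono (hip.add him).neg hi fun y => ?_
        have hup := discreteLaplacian_regCoul_le hε hh hhε (x - y)
        simp only [charge, Set.indicator]
        by_cases hyp : y ∈ Ωp
        · have hlow := le_discreteLaplacian_regCoul hε hh hhε hd (hx y hyp)
          split_ifs <;> linarith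
        · split_ifs <;> linarith

theorem not_isLocalMax_regNewton_add {Ωp Ωm : Set E3}
    (hp : MeasurableSet Ωp) (hpv : volume Ωp < ⊤) (hm : MeasurableSet Ωm) (hmv : volume Ωm < ⊤)
    {ε δ d : ℝ} (hε : 0 < ε) (hδ : 0 < δ) (hd : 0 < d) {x : E3} (hx : ∀ y ∈ Ωp, d ≤ ‖x - y‖)
    (hεδ : 3 * ε ^ 2 / d ^ 5 * volume.real Ωp ≤ δ) :
    ¬ IsLocalMax (fun z => regNewton ε (charge Ωp Ωm) z + δ * ‖z‖ ^ 2) x := by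
  intro hmax
  set C := 162 / ε ^ 4 * volume.real Ωp + 163 / ε ^ 4 * volume.real Ωm with hC
  have hsmall : Filter.Tendsto (fun h : ℝ => C * h) (nhdsWithin 0 (Set.Ioi 0)) (nhds 0) := by
    have := ((continuous_id (X := ℝ)).const_mul C).tendsto 0
    simp only [id, mul_zero] at this
    exact this.mono_left nhdsWithin_le_nhds
  obtain ⟨h, hle, ⟨hh, hhε⟩, hCh⟩ := ((discreteLaplacian_nonpos_of_isLocalMax hmax).and
    ((Filter.eventually_mem_set.mpr (Ioo_mem_nhdsGT (by positivity : 0 < ε / 6))).and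
      (hsmall.eventually_lt_const (by positivity : 0 < 5 * δ)))).exists
  rw [discreteLaplacian_add, discreteLaplacian_const_mul_norm_sq] at hle
  have hlow := le_discreteLaplacian_regNewton_charge hp hpv hm hmv hε hh hhε.le hd hx
  have h2 : 0 < h ^ 2 := by positivity
  have e : (3 * ε ^ 2 / d ^ 5 * h ^ 2 + 162 / ε ^ 4 * h ^ 3) * volume.real Ωp
      + 163 / ε ^ 4 * h ^ 3 * volume.real Ωm
      = h ^ 2 * (3 * ε ^ 2 / d ^ 5 * volume.real Ωp + C * h) := by rw [hC]; ring
  rw [e] at hlow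
  nlinarith

/-- The weak maximum principle, for an open set at positive distance from the positive charge. -/
theorem newton_charge_nonpos_of_frontier {Ωp Ωm V : Set E3}
    (hp : MeasurableSet Ωp) (hpv : volume Ωp < ⊤) (hm : MeasurableSet Ωm) (hmv : volume Ωm < ⊤)
    (hV : IsOpen V) (hdisj : Disjoint (closure V) (closure Ωp))
    (hfr : ∀ y ∈ frontier V, newton (charge Ωp Ωm) y ≤ 0) {x : E3} (hx : x ∈ V) :
    newton (charge Ωp Ωm) x ≤ 0 := by
  have hf := integrable_charge hp hpv hm hmv
  have hf1 := abs_charge_le_one Ωp Ωm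
  set φ := newton (charge Ωp Ωm)
  have hφc : Continuous φ := continuous_newton hf hf1
  by_contra! hc
  set c := φ x
  obtain ⟨K', hK', hK'sub⟩ := Filter.mem_cocompact.mp
    ((tendsto_newton hf hf1).eventually_lt_const (half_pos hc))
  have hK'mem : ∀ z, c / 2 ≤ φ z → z ∈ K' := fun z hz => by
    by_contra hn
    exact absurd (hK'sub hn) (not_lt.mpr hz)
  obtain ⟨R, hR⟩ := hK'.isBounded.subset_closedBall 0
  have hnorm : ∀ z ∈ K', ‖z‖ ^ 2 ≤ R ^ 2 := fun z hz => by
    have := mem_closedBall_zero_iff.mp (hR hz)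
    gcongr
  have hKc : IsCompact (closure V ∩ K') := hK'.inter_left isClosed_closure
  obtain ⟨d, hd, hdd⟩ : ∃ d, 0 < d ∧ ∀ z ∈ closure V ∩ K', ∀ y ∈ Ωp, d ≤ ‖z - y‖ := by
    obtain ⟨r, hr, hlt⟩ := Metric.exists_pos_forall_lt_edist hKc isClosed_closure
      (hdisj.mono_left Set.inter_subset_left)
    refine ⟨r, hr, fun z hz y hy => ?_⟩
    have := hlt z hz y (subset_closure hy)
    rw [edist_dist, ← ENNReal.ofReal_coe_nnreal, dist_eq_norm] at this
    exact ((ENNReal.ofReal_lt_ofReal_iff_of_nonneg r.coe_nonneg).mp this).le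
  set δ := c / (8 * (R ^ 2 + 1)) with hδ
  have hδpos : 0 < δ := by positivity
  have hδR : ∀ z ∈ K', δ * ‖z‖ ^ 2 ≤ c / 8 := fun z hz => by
    calc δ * ‖z‖ ^ 2 ≤ δ * (R ^ 2 + 1) := by
          gcongr; linarith [hnorm z hz]
      _ = c / 8 := by rw [hδ]; field_simp
  have hsmall : Filter.Tendsto (fun ε : ℝ => 3 * ε ^ 2 / d ^ 5 * volume.real Ωp)
      (nhdsWithin 0 (Set.Ioi 0)) (nhds 0) := by
    have hcont : Continuous fun ε : ℝ => 3 * ε ^ 2 / d ^ 5 * volume.real Ωp := by fun_prop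
    have := hcont.tendsto 0
    norm_num at this
    exact this.mono_left nhdsWithin_le_nhds
  obtain ⟨ε, hunif, hεδ, hε⟩ := ((Metric.tendstoUniformly_iff.mp
    (tendstoUniformly_regNewton hf hf1) (c / 8) (by positivity)).and
      ((hsmall.eventually_lt_const hδpos).and self_mem_nhdsWithin)).exists
  have happ : ∀ z, |φ z - regNewton ε (charge Ωp Ωm) z| < c / 8 := hunif
  have hψc : Continuous fun z => regNewton ε (charge Ωp Ωm) z + δ * ‖z‖ ^ 2 :=
    (continuous_regNewton hf hε).add (by fun_prop)
  have hxK : x ∈ closure V ∩ K' := ⟨subset_closure hx, hK'mem x (by linarith)⟩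
  obtain ⟨y, hyK, hymax⟩ := hKc.exists_isMaxOn ⟨x, hxK⟩ hψc.continuousOn
  have hxy : regNewton ε (charge Ωp Ωm) x + δ * ‖x‖ ^ 2
    ≤ regNewton ε (charge Ωp Ωm) y + δ * ‖y‖ ^ 2 := hymax hxK
  have hφy : c / 2 < φ y := by
    have := abs_lt.mp (happ x)
    have := abs_lt.mp (happ y)
    have := hδR y hyK.2
    have : 0 ≤ δ * ‖x‖ ^ 2 := by positivity
    linarith
  have hyV : y ∈ V := by
    by_contra hn
    have := hfr y (by rw [hV.frontier_eq]; exact ⟨hyK.1, hn⟩)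
    linarith
  refine not_isLocalMax_regNewton_add hp hpv hm hmv hε hδpos hd (hdd y hyK) hεδ.le
    (hymax.isLocalMax ?_)
  filter_upwards [hV.mem_nhds hyV, hφc.continuousAt.eventually_const_lt hφy] with z hzV hz
  exact ⟨subset_closure hzV, hK'mem z hz.le⟩

theorem frontier_connectedComponentIn_inter {X : Type*} [TopologicalSpace X]
    [LocallyConnectedSpace X] {U : Set X} (hU : IsOpen U) (x : X) :
    frontier (connectedComponentIn U x) ∩ U = ∅ := by
  rw [hU.connectedComponentIn.frontier_eq]
  by_contra! hne
  obtain ⟨y, ⟨hyc, hyn⟩, hyU⟩ := hne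
  obtain ⟨z, hzy, hzx⟩ := mem_closure_iff.mp hyc _ (hU.connectedComponentIn (x := y))
    (mem_connectedComponentIn hyU)
  rw [connectedComponentIn_eq hzx, ← connectedComponentIn_eq hzy] at hyn
  exact hyn (mem_connectedComponentIn hyU)

/-- **Theorem 2.4(3)**: every connected component of the open representative
`Ω⁻ = {φ > 0} \ closure Ω⁺` of the minimizer touches the boundary of `Ω⁺`. -/
theorem minimizer_components_touch_boundary
    (Ωp : Set E3) (ho : IsOpen Ωp) (hb : Bornology.IsBounded Ωp)
    (hlip : HasLipschitzBoundary Ωp)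
    (Ωm : Set E3) (hadm : Adm Ωp Ωm)
    (hmin : ∀ A, Adm Ωp A → energy Ωp Ωm ≤ energy Ωp A) :
    ∀ x ∈ {x | 0 < potential Ωp Ωm x} \ closure Ωp,
      (frontier (connectedComponentIn ({x | 0 < potential Ωp Ωm x} \ closure Ωp) x) ∩
        frontier Ωp).Nonempty := by
  intro x hx
  by_contra hne
  rw [Set.not_nonempty_iff_eq_empty] at hne
  have hp := ho.measurableSet
  have hpv : volume Ωp < ⊤ := hb.measure_lt_top
  obtain ⟨hm, -, hmv⟩ := hadm
  have hφc : Continuous (potential Ωp Ωm) :=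
    continuous_newton (integrable_charge hp hpv hm hmv) (abs_charge_le_one Ωp Ωm)
  set U := {x | 0 < potential Ωp Ωm x} \ closure Ωp with hUdef
  have hU : IsOpen U := (isOpen_lt continuous_const hφc).sdiff isClosed_closure
  have hV : IsOpen (connectedComponentIn U x) := hU.connectedComponentIn
  have hVU : connectedComponentIn U x ⊆ U := connectedComponentIn_subset U x
  have hdisj : Disjoint (closure (connectedComponentIn U x)) (closure Ωp) := by
    rw [Set.disjoint_left]
    intro y hyV hyp
    refine Set.eq_empty_iff_forall_notMem.mp hne y ⟨?_, ?_⟩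
    · rw [hV.frontier_eq]
      exact ⟨hyV, fun h => (hVU h).2 hyp⟩
    · rw [ho.frontier_eq]
      refine ⟨hyp, fun h => ?_⟩
      obtain ⟨z, hzp, hzV⟩ := mem_closure_iff.mp hyV Ωp ho h
      exact (hVU hzV).2 (subset_closure hzp)
  refine absurd (newton_charge_nonpos_of_frontier hp hpv hm hmv hV hdisj (fun y hy => ?_)
    (mem_connectedComponentIn hx)) (not_le.mpr hx.1)
  by_contra! hpos
  have hyU : y ∈ U := ⟨hpos, Set.disjoint_left.mp hdisj (frontier_subset_closure hy)⟩
  exact Set.eq_empty_iff_forall_notMem.mp (frontier_connectedComponentIn_inter hU x) y ⟨hy, hyU⟩
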